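/- Let W = m_1P_1+⋯+m_sP_s be a fat point scheme in P^2 over a field of characteristic zero. Then the Hilbert polynomial of Ω^2_{R_W/K} is the constant Σ_{j=1}^s (1/2)(3m_j+2)(m_j−1). -/

import Mathlib

open MvPolynomial

/-- The homogeneous vanishing ideal of the `K`-rational point of `ℙ²` with homogeneous
coordinates `v`. -/
noncomputable def pointIdeal {K : Type*} [Field K] (v : Fin 3 → K) :
    Ideal (MvPolynomial (Fin 3) K) :=
  Ideal.span {F | (∃ d, F.IsHomogeneous d) ∧ MvPolynomial.eval v F = 0}

/-- The relation submodule of the presentation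
`Ω²_{R_W/K} ≅ Ω²_{S/K}/(I_W Ω²_{S/K} + dI_W ∧ Ω¹_{S/K})`, where `Ω²_{S/K}` is identified
with `S³` via the basis `dX₀∧dX₁, dX₀∧dX₂, dX₁∧dX₂`; the wedges `dF ∧ dX₀, dF ∧ dX₁,
dF ∧ dX₂` then have coordinate vectors `(-∂₁F, -∂₂F, 0)`, `(∂₀F, 0, -∂₂F)` and
`(0, ∂₀F, ∂₁F)`. -/
noncomputable def omega2Rel {K : Type*} [Field K] (IW : Ideal (MvPolynomial (Fin 3) K)) :
    Submodule (MvPolynomial (Fin 3) K) (Fin 3 → MvPolynomial (Fin 3) K) :=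
  Submodule.pi Set.univ
      (fun _ => (IW : Submodule (MvPolynomial (Fin 3) K) (MvPolynomial (Fin 3) K))) ⊔
    Submodule.span (MvPolynomial (Fin 3) K)
      {x | ∃ F ∈ IW,
        x = ![-(pderiv (1 : Fin 3) F), -(pderiv (2 : Fin 3) F), 0] ∨
        x = ![pderiv (0 : Fin 3) F, 0, -(pderiv (2 : Fin 3) F)] ∨
        x = ![0, pderiv (0 : Fin 3) F, pderiv (1 : Fin 3) F]}

/-- The value `HF_{Ω²_{R_W/K}}(i)`: the generators `dXⱼ∧dXₖ` have degree `2`, so the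
degree-`i` component consists of the vectors of homogeneous polynomials of degree `i - 2`,
modulo the degree-`i` component of the relation submodule. -/
noncomputable def omega2HF {K : Type*} [Field K] (IW : Ideal (MvPolynomial (Fin 3) K))
    (i : ℕ) : ℕ :=
  Module.finrank K
    (↥(Submodule.pi Set.univ fun _ : Fin 3 => homogeneousSubmodule (Fin 3) K (i - 2)) ⧸
      Submodule.comap
        (Submodule.pi Set.univ fun _ : Fin 3 => homogeneousSubmodule (Fin 3) K (i - 2)).subtype
        ((omega2Rel IW).restrictScalars K))

/-- Triples of ternary forms of degree `d`. -/
noncomputable abbrev formTriples (K : Type*) [Field K] (d : ℕ) :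
    Submodule K (Fin 3 → MvPolynomial (Fin 3) K) :=
  Submodule.pi Set.univ fun _ : Fin 3 => homogeneousSubmodule (Fin 3) K d

/-- The degree `d` component of a submodule of `S³`. -/
noncomputable def gradedPart {K : Type*} [Field K]
    (M : Submodule (MvPolynomial (Fin 3) K) (Fin 3 → MvPolynomial (Fin 3) K)) (d : ℕ) :
    Submodule K (formTriples K d) :=
  Submodule.comap (formTriples K d).subtype (M.restrictScalars K)

/-- The dimension of the degree `d` component of `S³ / M`. -/
noncomputable def quotientHF {K : Type*} [Field K]
    (M : Submodule (MvPolynomial (Fin 3) K) (Fin 3 → MvPolynomial (Fin 3) K)) (d : ℕ) : ℕ :=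
  Module.finrank K (formTriples K d ⧸ gradedPart M d)

section LinearAlgebra

variable {K V ι : Type*} [Field K] [AddCommGroup V] [Module K V] [Fintype ι]

theorem finrank_quotient_le_sum {U : ι → Type*} [∀ i, AddCommGroup (U i)] [∀ i, Module K (U i)]
    [∀ i, Module.Finite K (U i)] (Q : Submodule K V) (p : ∀ i, Submodule K (U i))
    (f : ∀ i, U i →ₗ[K] V) (hp : ∀ i, ∀ x ∈ p i, f i x ∈ Q)
    (hs : ∀ x, ∃ y : ∀ i, U i, x - ∑ i, f i (y i) ∈ Q) :
    Module.finrank K (V ⧸ Q) ≤ ∑ i, Module.finrank K (U i ⧸ p i) := by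
  classical
  let F : (∀ i, (U i ⧸ p i)) →ₗ[K] V ⧸ Q :=
    ∑ i, (p i).mapQ Q (f i) (fun x hx => hp i x hx) ∘ₗ LinearMap.proj i
  have hF : Function.Surjective F := by
    intro x
    obtain ⟨x, rfl⟩ := Q.mkQ_surjective x
    obtain ⟨y, hy⟩ := hs x
    refine ⟨fun i => (p i).mkQ (y i), ?_⟩
    rw [eq_comm, Submodule.mkQ_apply, ← sub_eq_zero]
    rw [← Submodule.Quotient.mk_eq_zero] at hy
    rw [← hy, ← Submodule.mkQ_apply, ← Submodule.mkQ_apply, map_sub, map_sum]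
    simp [F, LinearMap.sum_apply]
  rw [← Module.finrank_pi_fintype K]
  exact LinearMap.finrank_le_finrank_of_surjective hF

theorem sum_finrank_quotient_le [Module.Finite K V] (Q : Submodule K V) (Q' : ι → Submodule K V)
    (hle : ∀ i, Q ≤ Q' i) (hs : ∀ x : ι → V, ∃ w, ∀ i, w - x i ∈ Q' i) :
    ∑ i, Module.finrank K (V ⧸ Q' i) ≤ Module.finrank K (V ⧸ Q) := by
  let F : V ⧸ Q →ₗ[K] ∀ i, (V ⧸ Q' i) := LinearMap.pi fun i => Submodule.factor (hle i)
  have hF : Function.Surjective F := by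
    intro z
    choose x hx using fun i => (Q' i).mkQ_surjective (z i)
    obtain ⟨w, hw⟩ := hs x
    refine ⟨Q.mkQ w, ?_⟩
    ext1 i
    rw [← hx i]
    exact (Submodule.Quotient.eq _).2 (hw i)
  rw [← Module.finrank_pi_fintype K]
  exact LinearMap.finrank_le_finrank_of_surjective hF

end LinearAlgebra

section LocalToGlobal

variable {K : Type*} [Field K]

instance finite_formTriples (d : ℕ) : Module.Finite K (formTriples K d) := by
  have : ∀ _ : Fin 3, Module.Finite K (homogeneousSubmodule (Fin 3) K d) := fun _ =>
    Module.Finite.iff_fg.2 (homogeneousSubmodule_fg (Fin 3) K d)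
  let f : (Fin 3 → homogeneousSubmodule (Fin 3) K d) →ₗ[K] formTriples K d :=
    LinearMap.codRestrict _ (LinearMap.pi fun k => (homogeneousSubmodule (Fin 3) K d).subtype ∘ₗ
      LinearMap.proj k) fun x k _ => (x k).2
  refine Module.Finite.of_surjective f fun x => ⟨fun k => ⟨x.1 k, x.2 k trivial⟩, ?_⟩
  ext k : 2
  rfl

theorem mem_formTriples {d : ℕ} {x : Fin 3 → MvPolynomial (Fin 3) K} :
    x ∈ formTriples K d ↔ ∀ k, (x k).IsHomogeneous d := by
  simp [formTriples, Submodule.mem_pi]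

theorem smul_mem_formTriples {d e : ℕ} {g : MvPolynomial (Fin 3) K}
    (hg : g.IsHomogeneous e) {x : Fin 3 → MvPolynomial (Fin 3) K}
    (hx : x ∈ formTriples K (d - e)) (h : e ≤ d) : g • x ∈ formTriples K d := by
  rw [mem_formTriples] at hx ⊢
  intro k
  have := hg.mul (hx k)
  rwa [Nat.add_sub_cancel' h] at this

/-- Multiplication by a form of degree `e`, as a map between graded components. -/
noncomputable def mulForm {d e : ℕ} (g : MvPolynomial (Fin 3) K) (hg : g.IsHomogeneous e)
    (h : e ≤ d) : formTriples K (d - e) →ₗ[K] formTriples K d :=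
  LinearMap.restrict (LinearMap.lsmul (MvPolynomial (Fin 3) K) _ g |>.restrictScalars K)
    fun _ hx => smul_mem_formTriples hg hx h

@[simp]
theorem coe_mulForm {d e : ℕ} (g : MvPolynomial (Fin 3) K) (hg : g.IsHomogeneous e)
    (h : e ≤ d) (x : formTriples K (d - e)) :
    (mulForm g hg h x : Fin 3 → MvPolynomial (Fin 3) K) = g • x.1 := rfl

/-- If forms `g j` separate the modules `M' j ≥ M`, then in high degrees the Hilbert function
of `S³ / M` is the sum of those of the `S³ / M' j`. -/
theorem quotientHF_eq_sum {ι : Type*} [Fintype ι] [DecidableEq ι]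
    (M : Submodule (MvPolynomial (Fin 3) K) (Fin 3 → MvPolynomial (Fin 3) K))
    (M' : ι → Submodule (MvPolynomial (Fin 3) K) (Fin 3 → MvPolynomial (Fin 3) K))
    (g : ι → MvPolynomial (Fin 3) K) (e : ι → ℕ) (hg : ∀ j, (g j).IsHomogeneous (e j))
    (hle : ∀ j, M ≤ M' j) (hmul : ∀ j, ∀ x ∈ M' j, g j • x ∈ M)
    (hsep : ∀ i j, i ≠ j → ∀ x, g j • x ∈ M' i)
    (N : ℕ) (heN : ∀ j, e j ≤ N)
    (hgen : ∀ d ≥ N, ∀ x ∈ formTriples K d, ∃ y : ι → Fin 3 → MvPolynomial (Fin 3) K,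
      (∀ j, y j ∈ formTriples K (d - e j)) ∧ x - ∑ j, g j • y j ∈ M)
    (t : ι → ℕ) (ht : ∀ j, ∀ d ≥ N, quotientHF (M' j) d = t j) :
    ∀ d ≥ N + N, quotientHF M d = ∑ j, t j := by
  intro d hd
  have hed : ∀ j, e j ≤ d := fun j => (heN j).trans (by omega)
  apply le_antisymm
  · calc quotientHF M d ≤ ∑ j, quotientHF (M' j) (d - e j) := by
          refine finrank_quotient_le_sum _ _ (fun j => mulForm (g j) (hg j) (hed j))
            (fun j x hx => hmul j _ hx) fun x => ?_
          obtain ⟨y, hy, hxy⟩ := hgen d (by omega) x.1 x.2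
          refine ⟨fun j => ⟨y j, hy j⟩, ?_⟩
          change ((x - ∑ j, mulForm (g j) (hg j) (hed j) ⟨y j, hy j⟩ : formTriples K d) :
            Fin 3 → MvPolynomial (Fin 3) K) ∈ M
          simpa using hxy
      _ = ∑ j, t j := Finset.sum_congr rfl fun j _ => ht j _ (by have := heN j; omega)
  · calc ∑ j, t j = ∑ j, quotientHF (M' j) d :=
          Finset.sum_congr rfl fun j _ => (ht j _ (by omega)).symm
      _ ≤ quotientHF M d := by
        refine sum_finrank_quotient_le _ _ (fun j x hx => hle j hx) fun x => ?_
        choose y hy hxy using fun j => hgen d (by omega) (x j).1 (x j).2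
        let w : formTriples K d := ∑ j, mulForm (g j) (hg j) (hed j) ⟨y j j, hy j j⟩
        have hw : (w : Fin 3 → MvPolynomial (Fin 3) K) = ∑ j, g j • y j j := by
          simp [w]
        refine ⟨w, fun j => ?_⟩
        change (w : Fin 3 → MvPolynomial (Fin 3) K) - x j ∈ M' j
        rw [hw]
        have h₁ := hle j (hxy j)
        have h₂ : ∑ i, g i • (y i i - y j i) ∈ M' j := by
          refine Submodule.sum_mem _ fun i _ => ?_
          by_cases hij : j = i
          · subst hij
            simp
          · exact hsep j i hij _
        have := sub_mem h₂ h₁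
        convert this using 1
        simp only [smul_sub, Finset.sum_sub_distrib]
        abel

end LocalToGlobal

section Relations

variable {K : Type*} [Field K]

theorem pi_le_omega2Rel (I : Ideal (MvPolynomial (Fin 3) K)) {x : Fin 3 → MvPolynomial (Fin 3) K}
    (hx : ∀ k, x k ∈ I) : x ∈ omega2Rel I :=
  Submodule.mem_sup_left fun k _ => hx k

theorem wedge_X0_mem_omega2Rel {I : Ideal (MvPolynomial (Fin 3) K)} {F : MvPolynomial (Fin 3) K}
    (hF : F ∈ I) : ![-(pderiv (1 : Fin 3) F), -(pderiv (2 : Fin 3) F), 0] ∈ omega2Rel I :=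
  Submodule.mem_sup_right (Submodule.subset_span ⟨F, hF, Or.inl rfl⟩)

theorem wedge_X1_mem_omega2Rel {I : Ideal (MvPolynomial (Fin 3) K)} {F : MvPolynomial (Fin 3) K}
    (hF : F ∈ I) : ![pderiv (0 : Fin 3) F, 0, -(pderiv (2 : Fin 3) F)] ∈ omega2Rel I :=
  Submodule.mem_sup_right (Submodule.subset_span ⟨F, hF, Or.inr (Or.inl rfl)⟩)

theorem wedge_X2_mem_omega2Rel {I : Ideal (MvPolynomial (Fin 3) K)} {F : MvPolynomial (Fin 3) K}
    (hF : F ∈ I) : ![0, pderiv (0 : Fin 3) F, pderiv (1 : Fin 3) F] ∈ omega2Rel I :=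
  Submodule.mem_sup_right (Submodule.subset_span ⟨F, hF, Or.inr (Or.inr rfl)⟩)

theorem omega2Rel_le {I : Ideal (MvPolynomial (Fin 3) K)}
    {M : Submodule (MvPolynomial (Fin 3) K) (Fin 3 → MvPolynomial (Fin 3) K)}
    (h : ∀ x : Fin 3 → MvPolynomial (Fin 3) K, (∀ k, x k ∈ I) → x ∈ M)
    (h₀ : ∀ F ∈ I, ![-(pderiv (1 : Fin 3) F), -(pderiv (2 : Fin 3) F), 0] ∈ M)
    (h₁ : ∀ F ∈ I, ![pderiv (0 : Fin 3) F, 0, -(pderiv (2 : Fin 3) F)] ∈ M)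
    (h₂ : ∀ F ∈ I, ![0, pderiv (0 : Fin 3) F, pderiv (1 : Fin 3) F] ∈ M) :
    omega2Rel I ≤ M := by
  refine sup_le (fun x hx => h x fun k => hx k trivial) (Submodule.span_le.2 ?_)
  rintro x ⟨F, hF, rfl | rfl | rfl⟩
  exacts [h₀ F hF, h₁ F hF, h₂ F hF]

theorem omega2Rel_mono {I J : Ideal (MvPolynomial (Fin 3) K)} (h : I ≤ J) :
    omega2Rel I ≤ omega2Rel J :=
  omega2Rel_le (fun _ hx => pi_le_omega2Rel J fun k => h (hx k))
    (fun _ hF => wedge_X0_mem_omega2Rel (h hF)) (fun _ hF => wedge_X1_mem_omega2Rel (h hF))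
    fun _ hF => wedge_X2_mem_omega2Rel (h hF)

/-- Since `G² dF = d(G² F) - 2 G F dG`, squares of multipliers `J → I` carry the relations of `J`
to those of `I`. -/
theorem sq_smul_mem_omega2Rel {I J : Ideal (MvPolynomial (Fin 3) K)} {G : MvPolynomial (Fin 3) K}
    (hG : ∀ F ∈ J, G * F ∈ I) {x : Fin 3 → MvPolynomial (Fin 3) K} (hx : x ∈ omega2Rel J) :
    G ^ 2 • x ∈ omega2Rel I := by
  suffices omega2Rel J ≤ (omega2Rel I).comap (LinearMap.lsmul _ _ (G ^ 2)) from this hx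
  have hsq : ∀ F ∈ J, G ^ 2 * F ∈ I := fun F hF => by
    simpa [sq, mul_assoc] using I.mul_mem_left G (hG F hF)
  have hsmul : ∀ F ∈ J, ∀ b : Fin 3 → MvPolynomial (Fin 3) K, (G * F) • b ∈ omega2Rel I :=
    fun F hF b => pi_le_omega2Rel I fun k => I.mul_mem_right _ (hG F hF)
  refine omega2Rel_le (fun x hx => pi_le_omega2Rel I fun k => hsq _ (hx k)) ?_ ?_ ?_
  · intro F hF
    have := sub_mem (wedge_X0_mem_omega2Rel (hsq F hF)) (hsmul F hF
      (2 • ![-(pderiv (1 : Fin 3) G), -(pderiv (2 : Fin 3) G), 0]))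
    rw [Submodule.mem_comap]
    convert this using 1
    ext1 k
    fin_cases k <;> simp <;> ring
  · intro F hF
    have := sub_mem (wedge_X1_mem_omega2Rel (hsq F hF)) (hsmul F hF
      (2 • ![pderiv (0 : Fin 3) G, 0, -(pderiv (2 : Fin 3) G)]))
    rw [Submodule.mem_comap]
    convert this using 1
    ext1 k
    fin_cases k <;> simp <;> ring
  · intro F hF
    have := sub_mem (wedge_X2_mem_omega2Rel (hsq F hF)) (hsmul F hF
      (2 • ![0, pderiv (0 : Fin 3) G, pderiv (1 : Fin 3) G]))
    rw [Submodule.mem_comap]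
    convert this using 1
    ext1 k
    fin_cases k <;> simp <;> ring

end Relations

section Points

variable {K : Type*} [Field K]

theorem mem_pointIdeal {v : Fin 3 → K} {F : MvPolynomial (Fin 3) K} {d : ℕ}
    (hF : F.IsHomogeneous d) (h : eval v F = 0) : F ∈ pointIdeal v :=
  Ideal.subset_span ⟨⟨d, hF⟩, h⟩

theorem homogeneousComponent_mem_iInf_pow {ι : Type*} (v : ι → Fin 3 → K) (m : ι → ℕ)
    {F : MvPolynomial (Fin 3) K} (hF : F ∈ ⨅ j, pointIdeal (v j) ^ m j) (d : ℕ) :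
    homogeneousComponent d F ∈ ⨅ j, pointIdeal (v j) ^ m j := by
  let _ := gradedAlgebra (R := K) (σ := Fin 3)
  refine homogeneousComponent_mem_of_mem (Ideal.IsHomogeneous.iInf fun j => ?_) hF d
  have h : (pointIdeal (v j)).IsHomogeneous (homogeneousSubmodule (Fin 3) K) :=
    Ideal.homogeneous_span _ _ fun x hx => hx.1
  induction m j with
  | zero => simpa using Ideal.IsHomogeneous.top _
  | succ n ih => simpa [pow_succ] using ih.mul h

theorem homogeneousComponent_mul_of_isHomogeneous {g b : MvPolynomial (Fin 3) K} {e d : ℕ}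
    (hg : g.IsHomogeneous e) (h : e ≤ d) :
    homogeneousComponent d (g * b) = g * homogeneousComponent (d - e) b := by
  let _ := gradedAlgebra (R := K) (σ := Fin 3)
  have := DirectSum.coe_decompose_mul_of_left_mem_of_le (homogeneousSubmodule (Fin 3) K)
    (b := b) hg h
  rw [← decomposition.decompose'_apply, ← decomposition.decompose'_apply]
  exact this

theorem exists_linear_form {u w : Fin 3 → K} (hu : u ≠ 0) (h : ∀ c : K, w ≠ c • u) :
    ∃ L : MvPolynomial (Fin 3) K, L.IsHomogeneous 1 ∧ eval u L = 0 ∧ eval w L ≠ 0 := by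
  obtain ⟨k, hk⟩ := Function.ne_iff.1 hu
  obtain ⟨l, hl⟩ := Function.ne_iff.1 (h (w k / u k))
  refine ⟨C (u k) * X l - C (u l) * X k, (isHomogeneous_C_mul_X _ _).sub
    (isHomogeneous_C_mul_X _ _), by simp [mul_comm], fun h0 => hl ?_⟩
  simp only [Pi.zero_apply] at hk
  simp only [map_sub, map_mul, eval_C, eval_X] at h0
  simp only [Pi.smul_apply, smul_eq_mul]
  field_simp
  linear_combination h0

theorem exists_separator {ι : Type*} [Fintype ι] [DecidableEq ι] (v : ι → Fin 3 → K)
    (hv0 : ∀ j, v j ≠ 0) (hdist : ∀ i j, i ≠ j → ∀ c : K, v i ≠ c • v j) (m : ι → ℕ) (j : ι) :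
    ∃ (G : MvPolynomial (Fin 3) K) (e : ℕ), G.IsHomogeneous e ∧ eval (v j) G ≠ 0 ∧
      ∀ i, i ≠ j → G ∈ pointIdeal (v i) ^ m i := by
  have hL : ∀ i, ∃ L : MvPolynomial (Fin 3) K, i ≠ j →
      L.IsHomogeneous 1 ∧ eval (v i) L = 0 ∧ eval (v j) L ≠ 0 := by
    intro i
    by_cases hij : i = j
    · exact ⟨0, fun h => absurd hij h⟩
    · obtain ⟨L, hL⟩ := exists_linear_form (hv0 i) (hdist j i (Ne.symm hij))
      exact ⟨L, fun _ => hL⟩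
  choose L hL using hL
  refine ⟨∏ i ∈ Finset.univ.erase j, L i ^ m i, _, IsHomogeneous.prod _ _ (fun i => 1 * m i)
    fun i hi => (hL i (Finset.ne_of_mem_erase hi)).1.pow _, ?_, fun i hi => ?_⟩
  · rw [map_prod]
    refine Finset.prod_ne_zero_iff.2 fun i hi => ?_
    rw [map_pow]
    exact pow_ne_zero _ (hL i (Finset.ne_of_mem_erase hi)).2.2
  · refine Ideal.mem_of_dvd _ (Finset.dvd_prod_of_mem _ (Finset.mem_erase.2 ⟨hi, Finset.mem_univ i⟩))
      (Ideal.pow_mem_pow (mem_pointIdeal (hL i hi).1 (hL i hi).2.1) _)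

/-- Fat points and forms not vanishing at the respective points have no common projective zero. -/
theorem exists_pow_idealOfVars_le {ι : Type*} [Fintype ι] (v : ι → Fin 3 → K) (m : ι → ℕ)
    (g : ι → MvPolynomial (Fin 3) K) (e : ι → ℕ) (hg : ∀ j, (g j).IsHomogeneous (e j))
    (hgv : ∀ j, eval (v j) (g j) ≠ 0) :
    ∃ N, idealOfVars (Fin 3) K ^ N ≤
      (⨅ j, pointIdeal (v j) ^ m j) ⊔ Ideal.span (Set.range g) := by
  refine Ideal.exists_pow_le_of_le_radical_of_fg ?_ (idealOfVars_fg _ _)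
  rw [Ideal.radical_eq_sInf]
  refine le_sInf ?_
  rintro P ⟨hP, hPp⟩
  obtain ⟨j, -, hj⟩ := (hPp.inf_le' (s := Finset.univ) (f := fun j => pointIdeal (v j) ^ m j)).1
    (by
      rw [Finset.inf_univ_eq_iInf]
      exact le_sup_left.trans hP)
  have hpj : pointIdeal (v j) ≤ P := hPp.le_of_pow_le hj
  have hgj : g j ∈ P := hP (Ideal.mem_sup_right (Ideal.subset_span ⟨j, rfl⟩))
  refine Ideal.span_le.2 ?_
  rintro _ ⟨k, rfl⟩
  have h₁ : C (eval (v j) (g j)) * X k ^ e j - C (v j k ^ e j) * g j ∈ P := by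
    refine hpj (mem_pointIdeal (d := e j) ((IsHomogeneous.C_mul ?_ _).sub ((hg j).C_mul _)) ?_)
    · exact isHomogeneous_X_pow k (e j)
    · simp [mul_comm]
  have h₂ : C (eval (v j) (g j)) * X k ^ e j ∈ P := by
    simpa using add_mem h₁ (P.mul_mem_left (C (v j k ^ e j)) hgj)
  have h₃ : (X k : MvPolynomial (Fin 3) K) ^ e j ∈ P := by
    have := P.mul_mem_left (C (eval (v j) (g j))⁻¹) h₂
    rwa [← mul_assoc, ← C_mul, inv_mul_cancel₀ (hgv j), C_1, one_mul] at this
  exact hPp.mem_of_pow_mem _ h₃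

theorem exists_homogeneous_combination {ι : Type*} [Fintype ι] {I : Ideal (MvPolynomial (Fin 3) K)}
    (hI : ∀ F ∈ I, ∀ d, homogeneousComponent d F ∈ I)
    (g : ι → MvPolynomial (Fin 3) K) (e : ι → ℕ) (hg : ∀ j, (g j).IsHomogeneous (e j)) {N : ℕ}
    (hN : idealOfVars (Fin 3) K ^ N ≤ I ⊔ Ideal.span (Set.range g)) {d : ℕ} (hd : N ≤ d)
    (he : ∀ j, e j ≤ d) {F : MvPolynomial (Fin 3) K} (hF : F.IsHomogeneous d) :
    ∃ y : ι → MvPolynomial (Fin 3) K, (∀ j, (y j).IsHomogeneous (d - e j)) ∧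
      F - ∑ j, g j * y j ∈ I := by
  have hFm : F ∈ idealOfVars (Fin 3) K ^ N := by
    rw [mem_pow_idealOfVars_iff']
    exact fun x hx => hF.coeff_eq_zero (by omega)
  obtain ⟨a, ha, b, hb, hab⟩ := Submodule.mem_sup.1 (hN hFm)
  obtain ⟨c, rfl⟩ := (Ideal.mem_span_range_iff_exists_fun).1 hb
  refine ⟨fun j => homogeneousComponent (d - e j) (c j),
    fun j => homogeneousComponent_isHomogeneous _ _, ?_⟩
  convert hI a ha d using 1
  rw [sub_eq_iff_eq_add, ← homogeneousComponent_eq_self hF, ← hab, map_add, map_sum]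
  congr 1
  exact Finset.sum_congr rfl fun j _ => by
    rw [mul_comm, homogeneousComponent_mul_of_isHomogeneous (hg j) (he j)]

end Points

theorem exists_quotientHF_iInf_eq_sum {K : Type*} [Field K] {s : ℕ}
    (v : Fin s → (Fin 3 → K)) (hv0 : ∀ j, v j ≠ 0)
    (hdist : ∀ i j, i ≠ j → ∀ c : K, v i ≠ c • v j) (m t : Fin s → ℕ)
    (ht : ∀ j, ∃ N, ∀ d ≥ N, quotientHF (omega2Rel (pointIdeal (v j) ^ m j)) d = t j) :
    ∃ N, ∀ d ≥ N, quotientHF (omega2Rel (⨅ j, pointIdeal (v j) ^ m j)) d = ∑ j, t j := by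
  choose G e hG hGv hGm using exists_separator v hv0 hdist m
  choose N hN using ht
  have hG2 : ∀ j, (G j ^ 2).IsHomogeneous (e j * 2) := fun j => (hG j).pow 2
  obtain ⟨N', hN'⟩ := exists_pow_idealOfVars_le v m (fun j => G j ^ 2) _ hG2
    fun j => by simpa using hGv j
  let B := N' + ∑ j, N j + ∑ j, e j * 2
  have hNB : ∀ j, N j ≤ B := fun j => by
    have := Finset.single_le_sum (f := N) (fun _ _ => Nat.zero_le _) (Finset.mem_univ j)
    omega
  have heB : ∀ j, e j * 2 ≤ B := fun j => by
    have := Finset.single_le_sum (f := fun j => e j * 2) (fun _ _ => Nat.zero_le _)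
      (Finset.mem_univ j)
    omega
  refine ⟨B + B, quotientHF_eq_sum _ _ (fun j => G j ^ 2) _ hG2
    (fun j => omega2Rel_mono (iInf_le _ j)) (fun j x hx => sq_smul_mem_omega2Rel ?_ hx) ?_ B heB
    ?_ t fun j d hd => hN j d ((hNB j).trans hd)⟩
  · intro F hF
    rw [Ideal.mem_iInf]
    intro i
    by_cases hij : i = j
    · subst hij
      exact Ideal.mul_mem_left _ _ hF
    · exact Ideal.mul_mem_right _ _ (hGm j i hij)
  · intro i j hij x
    refine pi_le_omega2Rel _ fun k => ?_
    change G j ^ 2 * x k ∈ _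
    rw [sq, mul_assoc]
    exact Ideal.mul_mem_right _ _ (hGm j i hij)
  · intro d hd x hx
    rw [mem_formTriples] at hx
    choose y hy hxy using fun k => exists_homogeneous_combination
      (fun F hF => homogeneousComponent_mem_iInf_pow v m hF) (fun j => G j ^ 2) _ hG2 hN'
      (show N' ≤ d by omega) (fun j => (heB j).trans hd) (hx k)
    refine ⟨fun j k => y k j, fun j => mem_formTriples.2 fun k => hy k j,
      pi_le_omega2Rel _ fun k => ?_⟩
    simpa using hxy k

section CoordinateChange

variable {K : Type*} [Field K]

/-- The coordinates of `dF ∧ dG` in the basis `dX₀∧dX₁, dX₀∧dX₂, dX₁∧dX₂`. -/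
noncomputable def wedge (F G : MvPolynomial (Fin 3) K) : Fin 3 → MvPolynomial (Fin 3) K :=
  ![pderiv 0 F * pderiv 1 G - pderiv 1 F * pderiv 0 G,
    pderiv 0 F * pderiv 2 G - pderiv 2 F * pderiv 0 G,
    pderiv 1 F * pderiv 2 G - pderiv 2 F * pderiv 1 G]

theorem wedge_mem_omega2Rel {I : Ideal (MvPolynomial (Fin 3) K)} {F : MvPolynomial (Fin 3) K}
    (hF : F ∈ I) (G : MvPolynomial (Fin 3) K) : wedge F G ∈ omega2Rel I := by
  have := add_mem (add_mem
    ((omega2Rel I).smul_mem (pderiv 0 G) (wedge_X0_mem_omega2Rel hF))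
    ((omega2Rel I).smul_mem (pderiv 1 G) (wedge_X1_mem_omega2Rel hF)))
    ((omega2Rel I).smul_mem (pderiv 2 G) (wedge_X2_mem_omega2Rel hF))
  convert this using 1
  ext1 k
  fin_cases k <;> simp [wedge] <;> ring

theorem pderiv_algHom (σ : MvPolynomial (Fin 3) K →ₐ[K] MvPolynomial (Fin 3) K) (l : Fin 3)
    (F : MvPolynomial (Fin 3) K) :
    pderiv l (σ F) = ∑ k, σ (pderiv k F) * pderiv l (σ (X k)) := by
  induction F using MvPolynomial.induction_on with
  | C a =>
    rw [← algebraMap_eq, σ.commutes]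
    simp
  | add p q hp hq => simp [hp, hq, add_mul, Finset.sum_add_distrib]
  | mul_X p i hp =>
    rw [map_mul, pderiv_mul, hp]
    simp only [pderiv_mul, map_add, map_mul, add_mul, Finset.sum_add_distrib, pderiv_X]
    congr 1
    · rw [Finset.sum_mul]
      exact Finset.sum_congr rfl fun k _ => by ring
    · rw [Finset.sum_eq_single i (fun k _ hk => by simp [hk.symm]) (by simp)]
      simp

/-- The map induced on two-forms by a `K`-algebra endomorphism of `S`. -/
noncomputable def formMap (σ : MvPolynomial (Fin 3) K →ₐ[K] MvPolynomial (Fin 3) K) :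
    (Fin 3 → MvPolynomial (Fin 3) K) →ₗ[K] (Fin 3 → MvPolynomial (Fin 3) K) where
  toFun x := σ (x 0) • wedge (σ (X 0)) (σ (X 1)) + σ (x 1) • wedge (σ (X 0)) (σ (X 2)) +
    σ (x 2) • wedge (σ (X 1)) (σ (X 2))
  map_add' x y := by
    simp only [Pi.add_apply, map_add, add_smul]
    abel
  map_smul' c x := by
    simp only [Pi.smul_apply, map_smul, smul_assoc, RingHom.id_apply, smul_add]

variable (σ τ : MvPolynomial (Fin 3) K →ₐ[K] MvPolynomial (Fin 3) K)

theorem formMap_apply (x : Fin 3 → MvPolynomial (Fin 3) K) :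
    formMap σ x = σ (x 0) • wedge (σ (X 0)) (σ (X 1)) + σ (x 1) • wedge (σ (X 0)) (σ (X 2)) +
      σ (x 2) • wedge (σ (X 1)) (σ (X 2)) := rfl

theorem formMap_smul (f : MvPolynomial (Fin 3) K) (x : Fin 3 → MvPolynomial (Fin 3) K) :
    formMap σ (f • x) = σ f • formMap σ x := by
  simp only [formMap_apply, Pi.smul_apply, smul_eq_mul, map_mul, smul_add, mul_smul]

theorem formMap_wedge (F G : MvPolynomial (Fin 3) K) :
    formMap σ (wedge F G) = wedge (σ F) (σ G) := by
  ext1 k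
  simp only [formMap_apply, wedge, pderiv_algHom σ _ F, pderiv_algHom σ _ G, Fin.sum_univ_three]
  fin_cases k <;> simp <;> ring

theorem formMap_mem_formTriples (hσ : ∀ i, (σ (X i)).IsHomogeneous 1) {d : ℕ}
    {x : Fin 3 → MvPolynomial (Fin 3) K} (hx : x ∈ formTriples K d) :
    formMap σ x ∈ formTriples K d := by
  have hw : ∀ i j k, (wedge (σ (X i)) (σ (X j)) k).IsHomogeneous 0 := by
    intro i j k
    have hp : ∀ i l, (pderiv l (σ (X i))).IsHomogeneous 0 := fun i l => (hσ i).pderiv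
    fin_cases k <;> exact ((hp _ _).mul (hp _ _)).sub ((hp _ _).mul (hp _ _))
  have hx' : ∀ k, (σ (x k)).IsHomogeneous d := by
    intro k
    rw [mem_formTriples] at hx
    have := (hx k).aeval (σ ∘ X) hσ
    rwa [one_mul, ← aeval_unique] at this
  rw [mem_formTriples]
  intro k
  exact (((hx' 0).mul (hw _ _ k)).add ((hx' 1).mul (hw _ _ k))).add ((hx' 2).mul (hw _ _ k))

theorem formMap_mem_omega2Rel {I J : Ideal (MvPolynomial (Fin 3) K)} (h : ∀ F ∈ I, σ F ∈ J)
    {x : Fin 3 → MvPolynomial (Fin 3) K} (hx : x ∈ omega2Rel I) :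
    formMap σ x ∈ omega2Rel J := by
  let M : Submodule (MvPolynomial (Fin 3) K) (Fin 3 → MvPolynomial (Fin 3) K) :=
    { carrier := {x | formMap σ x ∈ omega2Rel J}
      add_mem' := fun {x y} hx hy => by
        simpa only [Set.mem_ofPred_eq, map_add] using add_mem hx hy
      zero_mem' := by simp
      smul_mem' := fun f x hx => by
        simpa only [Set.mem_ofPred_eq, formMap_smul] using Submodule.smul_mem _ _ hx }
  have hM : ∀ F ∈ I, ∀ G, wedge F G ∈ M := fun F hF G => by
    change formMap σ (wedge F G) ∈ omega2Rel J
    rw [formMap_wedge]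
    exact wedge_mem_omega2Rel (h F hF) _
  suffices omega2Rel I ≤ M from this hx
  refine omega2Rel_le (fun x hx => ?_) (fun F hF => ?_) (fun F hF => ?_) (fun F hF => ?_)
  · exact pi_le_omega2Rel J fun k => add_mem (add_mem (J.mul_mem_right _ (h _ (hx 0)))
      (J.mul_mem_right _ (h _ (hx 1)))) (J.mul_mem_right _ (h _ (hx 2)))
  · convert hM F hF (X 0) using 1
    ext1 k
    fin_cases k <;> simp [wedge, pderiv_X]
  · convert hM F hF (X 1) using 1
    ext1 k
    fin_cases k <;> simp [wedge, pderiv_X]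
  · convert hM F hF (X 2) using 1
    ext1 k
    fin_cases k <;> simp [wedge, pderiv_X]

theorem formMap_formMap (h : ∀ F, σ (τ F) = F) (x : Fin 3 → MvPolynomial (Fin 3) K) :
    formMap σ (formMap τ x) = x := by
  rw [formMap_apply τ]
  simp only [map_add, formMap_smul, formMap_wedge, h]
  ext1 k
  fin_cases k <;> simp [wedge, pderiv_X]

theorem quotientHF_omega2Rel_le (hσ : ∀ i, (σ (X i)).IsHomogeneous 1)
    (hτ : ∀ i, (τ (X i)).IsHomogeneous 1) (h : ∀ F, σ (τ F) = F)
    {I J : Ideal (MvPolynomial (Fin 3) K)} (hIJ : ∀ F ∈ I, σ F ∈ J) (d : ℕ) :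
    quotientHF (omega2Rel J) d ≤ quotientHF (omega2Rel I) d := by
  have := finrank_quotient_le_sum (ι := Unit) (gradedPart (omega2Rel J) d)
    (fun _ => gradedPart (omega2Rel I) d)
    (fun _ => (formMap σ).restrict fun x hx => formMap_mem_formTriples σ hσ hx)
    (fun _ x hx => formMap_mem_omega2Rel σ hIJ hx)
    (fun x => ⟨fun _ => ⟨_, formMap_mem_formTriples τ hτ x.2⟩, by
      convert zero_mem (gradedPart (omega2Rel J) d)
      rw [Finset.univ_unique, Finset.sum_singleton, sub_eq_zero]
      exact Subtype.ext (formMap_formMap σ τ h x.1).symm⟩)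
  simpa [quotientHF] using this

theorem quotientHF_omega2Rel_congr (hσ : ∀ i, (σ (X i)).IsHomogeneous 1)
    (hτ : ∀ i, (τ (X i)).IsHomogeneous 1) (h : ∀ F, σ (τ F) = F) (h' : ∀ F, τ (σ F) = F)
    {I J : Ideal (MvPolynomial (Fin 3) K)} (hIJ : ∀ F ∈ I, σ F ∈ J) (hJI : ∀ F ∈ J, τ F ∈ I)
    (d : ℕ) : quotientHF (omega2Rel I) d = quotientHF (omega2Rel J) d :=
  le_antisymm (quotientHF_omega2Rel_le τ σ hτ hσ h' hJI d)
    (quotientHF_omega2Rel_le σ τ hσ hτ h hIJ d)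

/-- The substitution `X_k ↦ ∑ l, f(e_l)_k X_l`. -/
noncomputable def linearSubst (f : (Fin 3 → K) →ₗ[K] (Fin 3 → K)) :
    MvPolynomial (Fin 3) K →ₐ[K] MvPolynomial (Fin 3) K :=
  aeval fun k => ∑ l, C (f (Pi.single l 1) k) * X l

theorem isHomogeneous_linearSubst_X (f : (Fin 3 → K) →ₗ[K] (Fin 3 → K)) (k : Fin 3) :
    (linearSubst f (X k)).IsHomogeneous 1 := by
  rw [linearSubst, aeval_X]
  exact IsHomogeneous.sum _ _ _ fun l _ => isHomogeneous_C_mul_X _ _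

theorem linearSubst_linearSubst (f g : (Fin 3 → K) →ₗ[K] (Fin 3 → K)) (h : ∀ x, f (g x) = x)
    (F : MvPolynomial (Fin 3) K) : linearSubst g (linearSubst f F) = F := by
  suffices (linearSubst g).comp (linearSubst f) = AlgHom.id K _ from DFunLike.congr_fun this F
  refine algHom_ext fun k => ?_
  have hf : ∀ x : Fin 3 → K, f x k = ∑ l, x l * f (Pi.single l 1) k := fun x => by
    conv_lhs => rw [pi_eq_sum_univ' x]
    simp [Finset.sum_apply]
  simp only [AlgHom.comp_apply, linearSubst, aeval_X, map_sum, map_mul, AlgHom.id_apply,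
    Finset.mul_sum]
  simp only [← algebraMap_eq, AlgHom.commutes]
  simp only [algebraMap_eq, ← mul_assoc, ← C_mul]
  rw [Finset.sum_comm]
  simp only [← Finset.sum_mul, ← map_sum]
  have : ∀ l, ∑ i, f (Pi.single i 1) k * g (Pi.single l 1) i = (Pi.single l 1 : Fin 3 → K) k :=
    fun l => by
      rw [← h (Pi.single l 1), hf (g _)]
      simp [mul_comm, h]
  simp only [this]
  rw [Finset.sum_eq_single k (fun l _ hl => by simp [hl.symm]) (by simp)]
  simp

theorem eval_linearSubst (f : (Fin 3 → K) →ₗ[K] (Fin 3 → K)) (x : Fin 3 → K)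
    (F : MvPolynomial (Fin 3) K) : eval x (linearSubst f F) = eval (f x) F := by
  have hf : ∀ k, f x k = ∑ l, x l * f (Pi.single l 1) k := fun k => by
    conv_lhs => rw [pi_eq_sum_univ' x]
    simp [Finset.sum_apply]
  induction F using MvPolynomial.induction_on with
  | C a => simp [linearSubst]
  | add p q hp hq => simp [hp, hq]
  | mul_X p i hp =>
    rw [map_mul, map_mul, hp, map_mul, eval_X, hf]
    simp [linearSubst, mul_comm]

theorem linearSubst_mem_pow (f : (Fin 3 → K) →ₗ[K] (Fin 3 → K)) (x : Fin 3 → K) (m : ℕ)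
    (F : MvPolynomial (Fin 3) K) (hF : F ∈ pointIdeal (f x) ^ m) :
    linearSubst f F ∈ pointIdeal x ^ m := by
  have h : (pointIdeal (f x)).map (linearSubst f) ≤ pointIdeal x := by
    rw [pointIdeal, Ideal.map_span, Ideal.span_le]
    rintro _ ⟨G, ⟨⟨d, hG⟩, hG0⟩, rfl⟩
    refine mem_pointIdeal (d := d) ?_ (by rwa [eval_linearSubst])
    have := hG.aeval (linearSubst f ∘ X) (isHomogeneous_linearSubst_X f)
    rwa [one_mul, ← aeval_unique] at this
  have := Ideal.mem_map_of_mem (linearSubst f) hF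
  rw [Ideal.map_pow] at this
  exact Ideal.pow_right_mono h m this

theorem exists_linearEquiv_apply_eq {V : Type*} [AddCommGroup V] [Module K V]
    [FiniteDimensional K V] {x y : V} (hx : x ≠ 0) (hy : y ≠ 0) :
    ∃ f : V ≃ₗ[K] V, f x = y := by
  obtain ⟨g, hg⟩ := Submodule.exists_linearEquiv_restrict_eq
    ((LinearEquiv.toSpanNonzeroSingleton K V x hx).symm ≪≫ₗ
      LinearEquiv.toSpanNonzeroSingleton K V y hy)
  refine ⟨g, ?_⟩
  have h := hg ⟨x, Submodule.mem_span_singleton_self x⟩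
  have hx1 : (LinearEquiv.toSpanNonzeroSingleton K V x hx).symm
      ⟨x, Submodule.mem_span_singleton_self x⟩ = 1 := by
    rw [LinearEquiv.symm_apply_eq]
    simp
  simpa [hx1] using h.symm

theorem quotientHF_pointIdeal_congr {u v : Fin 3 → K} (hu : u ≠ 0) (hv : v ≠ 0) (m d : ℕ) :
    quotientHF (omega2Rel (pointIdeal u ^ m)) d = quotientHF (omega2Rel (pointIdeal v ^ m)) d := by
  obtain ⟨f, rfl⟩ := exists_linearEquiv_apply_eq (K := K) hv hu
  refine quotientHF_omega2Rel_congr (linearSubst f.toLinearMap) (linearSubst f.symm.toLinearMap)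
    (isHomogeneous_linearSubst_X _) (isHomogeneous_linearSubst_X _)
    (linearSubst_linearSubst _ _ f.symm_apply_apply) (linearSubst_linearSubst _ _ f.apply_symm_apply)
    (linearSubst_mem_pow f.toLinearMap v m) (fun F hF => ?_) d
  refine linearSubst_mem_pow f.symm.toLinearMap (f v) m F ?_
  simpa using hF

end CoordinateChange

section StandardPoint

variable {K : Type*} [Field K]

theorem degree_fin_three (x : Fin 3 →₀ ℕ) : x.degree = x 0 + x 1 + x 2 := by
  rw [Finsupp.degree_eq_sum, Fin.sum_univ_three]

theorem mem_pow_pointIdeal_single (k : ℕ) (F : MvPolynomial (Fin 3) K) :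
    F ∈ pointIdeal (Pi.single 0 1 : Fin 3 → K) ^ k ↔ ∀ x, x 1 + x 2 < k → coeff x F = 0 := by
  let V : ℕ → Ideal (MvPolynomial (Fin 3) K) := fun k =>
    restrictSupportIdeal (R := K) {x : Fin 3 →₀ ℕ | k ≤ x 1 + x 2} fun x y hxy hx =>
      le_trans hx (add_le_add (hxy 1) (hxy 2))
  have hV : ∀ k F, F ∈ V k ↔ ∀ x, x 1 + x 2 < k → coeff x F = 0 := fun k F => by
    change (F.support : Set (Fin 3 →₀ ℕ)) ⊆ {x | k ≤ x 1 + x 2} ↔ _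
    refine forall_congr' fun x => ?_
    rw [SetLike.mem_coe, mem_support_iff, Set.mem_ofPred_eq, ← not_lt, not_imp_not]
  rw [← hV]
  suffices pointIdeal (Pi.single 0 1 : Fin 3 → K) ^ k = V k by rw [this]
  apply le_antisymm
  · clear F
    induction k with
    | zero => exact fun F _ => (hV 0 F).2 (by simp)
    | succ k ih =>
      rw [pow_succ, Ideal.mul_le]
      intro f hf g hg
      have hg : g ∈ V 1 := by
        refine (Ideal.span_le (I := V 1)).2 ?_ hg
        rintro F ⟨⟨d, hF⟩, hF0⟩
        refine (hV 1 F).2 fun x hx => ?_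
        by_contra hx0
        rw [eval_eq', Finset.sum_eq_single x] at hF0
        · have h1 : x 1 = 0 := by omega
          have h2 : x 2 = 0 := by omega
          simp [Fin.prod_univ_three, h1, h2] at hF0
          exact hx0 hF0
        · intro y hy hyx
          rw [Fin.prod_univ_three]
          have hxd := hF.coeff_eq_zero (d := x)
          have hyd := hF.coeff_eq_zero (d := y)
          rw [mem_support_iff] at hy
          have hxd : x.degree = d := by_contra fun h => hx0 (hxd h)
          have hyd : y.degree = d := by_contra fun h => hy (hyd h)
          rw [degree_fin_three] at hxd hyd
          have : y 1 ≠ 0 ∨ y 2 ≠ 0 := by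
            by_contra! h
            refine hyx (Finsupp.ext fun i => ?_)
            fin_cases i <;> simp <;> omega
          rcases this with h | h <;> simp [h]
        · intro h
          simp [notMem_support_iff.1 h]
      rw [hV] at hg ⊢
      have hf := (hV k f).1 (ih hf)
      intro x hx
      rw [coeff_mul]
      refine Finset.sum_eq_zero fun y hy => ?_
      rw [Finset.HasAntidiagonal.mem_antidiagonal] at hy
      subst hy
      simp only [Finsupp.add_apply] at hx
      by_cases hk : y.1 1 + y.1 2 < k
      · rw [hf _ hk, zero_mul]
      · rw [hg _ (by omega), mul_zero]
  · intro F hF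
    rw [hV] at hF
    rw [← support_sum_monomial_coeff F]
    refine Ideal.sum_mem _ fun x hx => ?_
    have hx : k ≤ x 1 + x 2 := not_lt.1 fun h => mem_support_iff.1 hx (hF x h)
    have hX : ∀ i, i ≠ 0 → (X i : MvPolynomial (Fin 3) K) ∈
        pointIdeal (Pi.single 0 1 : Fin 3 → K) := fun i hi =>
      mem_pointIdeal (isHomogeneous_X K i) (by simp [hi])
    rw [monomial_eq, Finsupp.prod_fintype _ _ (by simp), Fin.prod_univ_three, mul_assoc]
    refine Ideal.mul_mem_left _ _ (Ideal.mul_mem_left _ _ (Ideal.pow_le_pow_right hx ?_))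
    rw [pow_add]
    exact Ideal.mul_mem_mul (Ideal.pow_mem_pow (hX 1 (by decide)) _)
      (Ideal.pow_mem_pow (hX 2 (by decide)) _)

theorem X_mul_mem_pow_succ {k : ℕ} {i : Fin 3} (hi : i ≠ 0) {F : MvPolynomial (Fin 3) K}
    (hF : F ∈ pointIdeal (Pi.single 0 1 : Fin 3 → K) ^ k) :
    X i * F ∈ pointIdeal (Pi.single 0 1 : Fin 3 → K) ^ (k + 1) := by
  rw [pow_succ']
  exact Ideal.mul_mem_mul (mem_pointIdeal (isHomogeneous_X K i) (by simp [hi])) hF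

theorem pderiv_mem_pow {k : ℕ} (i : Fin 3) {F : MvPolynomial (Fin 3) K}
    (hF : F ∈ pointIdeal (Pi.single 0 1 : Fin 3 → K) ^ (k + 1)) :
    pderiv i F ∈ pointIdeal (Pi.single 0 1 : Fin 3 → K) ^ k := by
  rw [mem_pow_pointIdeal_single] at hF ⊢
  intro x hx
  rw [coeff_pderiv, hF _ _, zero_mul]
  fin_cases i <;> simp <;> omega

theorem pderiv_zero_mem_pow {k : ℕ} {F : MvPolynomial (Fin 3) K}
    (hF : F ∈ pointIdeal (Pi.single 0 1 : Fin 3 → K) ^ k) :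
    pderiv 0 F ∈ pointIdeal (Pi.single 0 1 : Fin 3 → K) ^ k := by
  rw [mem_pow_pointIdeal_single] at hF ⊢
  intro x hx
  rw [coeff_pderiv, hF _ (by simpa using hx), zero_mul]

theorem coeff_X_mul_pderiv {σ : Type*} (i : σ) (x : σ →₀ ℕ) (F : MvPolynomial σ K) :
    coeff x (X i * pderiv i F) = x i * coeff x F := by
  classical
  rw [coeff_X_mul']
  split_ifs with h
  · have h1 : 1 ≤ x i := Nat.one_le_iff_ne_zero.2 (Finsupp.mem_support_iff.1 h)
    have h2 : Finsupp.single i 1 ≤ x := Finsupp.single_le_iff.2 h1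
    rw [coeff_pderiv, tsub_add_cancel_of_le h2, mul_comm]
    congr 1
    simp [Nat.cast_sub h1]
  · rw [Finsupp.notMem_support_iff.1 h]
    simp

/-- Euler's relation in the variables `X₁, X₂`, modulo terms of higher order. -/
theorem euler_mem_pow {n : ℕ} {F : MvPolynomial (Fin 3) K}
    (hF : F ∈ pointIdeal (Pi.single 0 1 : Fin 3 → K) ^ n) :
    X 1 * pderiv 1 F + X 2 * pderiv 2 F - (n : K) • F ∈
      pointIdeal (Pi.single 0 1 : Fin 3 → K) ^ (n + 1) := by
  rw [mem_pow_pointIdeal_single] at hF ⊢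
  intro x hx
  rw [coeff_sub, coeff_add, coeff_X_mul_pderiv, coeff_X_mul_pderiv, coeff_smul, smul_eq_mul,
    ← add_mul, ← sub_mul]
  by_cases h : x 1 + x 2 < n
  · rw [hF x h, mul_zero]
  · rw [← show x 1 + x 2 = n by omega]
    simp

theorem pderiv_pderiv_comm {σ : Type*} (i j : σ) (F : MvPolynomial σ K) :
    pderiv i (pderiv j F) = pderiv j (pderiv i F) := by
  by_cases h : i = j
  · rw [h]
  · ext x
    simp only [coeff_pderiv, add_right_comm x, Finsupp.add_apply,
      Finsupp.single_eq_of_ne h, Finsupp.single_eq_of_ne (Ne.symm h), add_zero]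
    ring

theorem mem_omega2Rel_pow_single [CharZero K] (n : ℕ) (x : Fin 3 → MvPolynomial (Fin 3) K) :
    x ∈ omega2Rel (pointIdeal (Pi.single 0 1 : Fin 3 → K) ^ (n + 1)) ↔
      (∀ l, x l ∈ pointIdeal (Pi.single 0 1 : Fin 3 → K) ^ n) ∧
        pderiv 2 (x 0) - pderiv 1 (x 1) ∈ pointIdeal (Pi.single 0 1 : Fin 3 → K) ^ n := by
  constructor
  · let p := pointIdeal (Pi.single 0 1 : Fin 3 → K)
    let C : Submodule (MvPolynomial (Fin 3) K) (Fin 3 → MvPolynomial (Fin 3) K) :=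
      { carrier := {x | (∀ l, x l ∈ p ^ n) ∧ pderiv 2 (x 0) - pderiv 1 (x 1) ∈ p ^ n}
        zero_mem' := by simp
        add_mem' := fun {x y} hx hy => ⟨fun l => add_mem (hx.1 l) (hy.1 l), by
          convert add_mem hx.2 hy.2 using 1
          simp only [Pi.add_apply, map_add]
          ring⟩
        smul_mem' := fun f x hx => ⟨fun l => Ideal.mul_mem_left _ f (hx.1 l), by
          convert add_mem (Ideal.mul_mem_left _ f hx.2)
            (sub_mem (Ideal.mul_mem_left _ (pderiv 2 f) (hx.1 0))
              (Ideal.mul_mem_left _ (pderiv 1 f) (hx.1 1))) using 1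
          simp only [Pi.smul_apply, smul_eq_mul, pderiv_mul]
          ring⟩ }
    suffices omega2Rel (p ^ (n + 1)) ≤ C from fun hx => this hx
    have hle : p ^ (n + 1) ≤ p ^ n := Ideal.pow_le_pow_right n.le_succ
    refine omega2Rel_le (fun x hx => ⟨fun l => hle (hx l),
      sub_mem (pderiv_mem_pow 2 (hx 0)) (pderiv_mem_pow 1 (hx 1))⟩) ?_ ?_ ?_
    · refine fun F hF => ⟨fun l => ?_, ?_⟩
      · fin_cases l
        exacts [neg_mem (pderiv_mem_pow 1 hF), neg_mem (pderiv_mem_pow 2 hF), zero_mem _]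
      · convert zero_mem (p ^ n)
        simp [pderiv_pderiv_comm (1 : Fin 3) 2]
    · refine fun F hF => ⟨fun l => ?_, ?_⟩
      · fin_cases l
        exacts [pderiv_mem_pow 0 hF, zero_mem _, neg_mem (pderiv_mem_pow 2 hF)]
      · simpa using pderiv_mem_pow 2 (pderiv_zero_mem_pow hF)
    · refine fun F hF => ⟨fun l => ?_, ?_⟩
      · fin_cases l
        exacts [zero_mem _, pderiv_mem_pow 0 hF, pderiv_mem_pow 1 hF]
      · simpa using pderiv_mem_pow 1 (pderiv_zero_mem_pow hF)
  · rintro ⟨hx, hD⟩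
    set p := pointIdeal (Pi.single 0 1 : Fin 3 → K)
    set M := omega2Rel (p ^ (n + 1))
    have hmon : ∀ y : Fin 3 →₀ ℕ, monomial y (1 : K) ∈ p ^ n →
        (Pi.single 2 (monomial y 1) : Fin 3 → MvPolynomial (Fin 3) K) ∈ M := fun y hy => by
      have h := X_mul_mem_pow_succ (i := 1) (by decide) hy
      have h' := M.smul_of_tower_mem ((y 1 + 1 : K)⁻¹) (sub_mem (wedge_X2_mem_omega2Rel h)
        (pi_le_omega2Rel _ (x := ![0, pderiv 0 (X 1 * monomial y (1 : K)), 0]) fun l => by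
          fin_cases l
          exacts [zero_mem _, pderiv_zero_mem_pow h, zero_mem _]))
      have hy0 : (y 1 + 1 : K) ≠ 0 := by exact_mod_cast (y 1).succ_ne_zero
      convert h' using 1
      ext1 l
      fin_cases l
      · simp
      · simp
      · change monomial y 1 = (y 1 + 1 : K)⁻¹ • (pderiv 1 (X 1 * monomial y (1 : K)) - 0)
        rw [sub_zero, pderiv_mul, pderiv_X_self, X_mul_pderiv_monomial, one_mul,
          ← Nat.cast_smul_eq_nsmul K,
          show monomial y (1 : K) + (y 1 : K) • monomial y 1 = (y 1 + 1 : K) • monomial y 1 by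
            rw [add_smul, one_smul, add_comm], inv_smul_smul₀ hy0]
    have hc : ∀ c ∈ p ^ n, (Pi.single 2 c : Fin 3 → MvPolynomial (Fin 3) K) ∈ M := fun c hc => by
      suffices LinearMap.single (MvPolynomial (Fin 3) K) (fun _ => MvPolynomial (Fin 3) K) 2 c ∈ M
        from this
      rw [← support_sum_monomial_coeff c, map_sum]
      refine sum_mem fun y hy => ?_
      rw [show monomial y (coeff y c) = C (coeff y c) * monomial y 1 by
        rw [C_mul_monomial, mul_one], ← smul_eq_mul, map_smul]
      refine M.smul_mem _ (hmon y ?_)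
      rw [mem_pow_pointIdeal_single] at hc ⊢
      intro z hz
      rw [coeff_monomial, if_neg]
      rintro rfl
      exact mem_support_iff.1 hy (hc y hz)
    have hF : X 1 * x 0 + X 2 * x 1 ∈ p ^ (n + 1) :=
      add_mem (X_mul_mem_pow_succ (by decide) (hx 0)) (X_mul_mem_pow_succ (by decide) (hx 1))
    have h0 := sub_mem (euler_mem_pow (hx 0)) (X_mul_mem_pow_succ (i := 2) (by decide) hD)
    have h1 := add_mem (euler_mem_pow (hx 1)) (X_mul_mem_pow_succ (i := 1) (by decide) hD)
    have hn0 : (n + 1 : K) ≠ 0 := by exact_mod_cast n.succ_ne_zero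
    have := add_mem (hc _ (hx 2)) (M.smul_of_tower_mem (-(n + 1 : K)⁻¹)
      (add_mem (wedge_X0_mem_omega2Rel hF) (pi_le_omega2Rel _ (x := ![_, _, 0]) fun l => by
        fin_cases l
        exacts [h0, h1, zero_mem _])))
    convert this using 1
    have hneg : ∀ a b : MvPolynomial (Fin 3) K, b = -((n + 1 : K) • a) →
        a = 0 + -(n + 1 : K)⁻¹ • b := fun a b h => by
      rw [h, neg_smul, smul_neg, neg_neg, inv_smul_smul₀ hn0, zero_add]
    ext1 l
    fin_cases l
    · refine hneg _ _ ?_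
      simp [smul_eq_C_mul]
      ring
    · refine hneg _ _ ?_
      simp [smul_eq_C_mul]
      ring
    · simp

end StandardPoint

section HilbertFunction

variable {K : Type*} [Field K]

theorem exists_isHomogeneous_coeff_eq (d : ℕ) (φ : (Fin 3 →₀ ℕ) → K) :
    ∃ F : MvPolynomial (Fin 3) K, F.IsHomogeneous d ∧ ∀ x, x.degree = d → coeff x F = φ x := by
  classical
  have hmem : ∀ x : Fin 3 →₀ ℕ, x ∈ Finset.univ.finsuppAntidiag d ↔ x.degree = d := fun x => by
    simp [Finset.mem_finsuppAntidiag, Finsupp.degree_eq_sum]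
  refine ⟨∑ x ∈ Finset.univ.finsuppAntidiag d, monomial x (φ x),
    IsHomogeneous.sum _ _ _ fun x hx => isHomogeneous_monomial _ ((hmem x).1 hx),
    fun x hx => ?_⟩
  simp only [coeff_sum, coeff_monomial]
  rw [Finset.sum_ite_eq', if_pos ((hmem x).2 hx)]

/-- The exponents of degree `d` and order `< n` in the last two variables. -/
noncomputable def lowExponent (d n : ℕ) (q : Σ k : Fin n, Fin (k + 1)) : Fin 3 →₀ ℕ :=
  Finsupp.equivFunOnFinite.symm ![d - q.1, q.2, q.1 - q.2]

/-- The exponents of degree `d - 1` and order `n - 1` in the last two variables. -/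
noncomputable def edgeExponent (d n : ℕ) (i : Fin n) : Fin 3 →₀ ℕ :=
  Finsupp.equivFunOnFinite.symm ![d - n, i, n - 1 - i]

/-- The coefficients of a two-form which vanish when it is a relation at the standard point. -/
noncomputable def lowCoeffs (d n : ℕ) : formTriples K d →ₗ[K]
    (Fin 3 → (Σ k : Fin n, Fin (k + 1)) → K) × (Fin n → K) :=
  LinearMap.prod
    (LinearMap.pi fun l => LinearMap.pi fun q =>
      lcoeff K (lowExponent d n q) ∘ₗ LinearMap.proj l ∘ₗ (formTriples K d).subtype)
    (LinearMap.pi fun i => lcoeff K (edgeExponent d n i) ∘ₗ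
      ((pderiv 2).toLinearMap ∘ₗ LinearMap.proj 0 - (pderiv 1).toLinearMap ∘ₗ LinearMap.proj 1) ∘ₗ
        (formTriples K d).subtype)

theorem lowCoeffs_apply (d n : ℕ) (x : formTriples K d) :
    lowCoeffs d n x = (fun l q => coeff (lowExponent d n q) (x.1 l), fun i =>
      coeff (edgeExponent d n i) (pderiv 2 (x.1 0) - pderiv 1 (x.1 1))) := rfl

theorem lowExponent_injective (d n : ℕ) : Function.Injective (lowExponent d n) := by
  rintro ⟨k, i⟩ ⟨k', i'⟩ h
  have h1 : (i : ℕ) = i' := by simpa [lowExponent] using DFunLike.congr_fun h 1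
  have h2 : (k : ℕ) - i = k' - i' := by simpa [lowExponent] using DFunLike.congr_fun h 2
  obtain rfl : k = k' := by
    ext
    omega
  obtain rfl : i = i' := by
    ext
    omega
  rfl

theorem sumElim_lowExponent_injective (d n : ℕ) : Function.Injective
    (Sum.elim (lowExponent d n) fun i => edgeExponent d n i + Finsupp.single 2 1) := by
  refine (lowExponent_injective d n).sumElim (fun i j h => ?_) fun q i h => ?_
  · have := DFunLike.congr_fun h 1
    simp [edgeExponent] at this
    exact Fin.ext this
  · have h1 := DFunLike.congr_fun h 1
    have h2 := DFunLike.congr_fun h 2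
    simp [lowExponent, edgeExponent] at h1 h2
    omega

theorem degree_lowExponent {d n : ℕ} (h : n ≤ d) (q : Σ k : Fin n, Fin (k + 1)) :
    (lowExponent d n q).degree = d := by
  simp [degree_fin_three, lowExponent]
  omega

theorem degree_edgeExponent {d n : ℕ} (h : n ≤ d) (i : Fin n) :
    (edgeExponent d n i).degree = d - 1 := by
  simp [degree_fin_three, edgeExponent]
  omega

theorem lowCoeffs_surjective [CharZero K] {d n : ℕ} (h : n ≤ d) :
    Function.Surjective (lowCoeffs (K := K) d n) := by
  rintro ⟨α, γ⟩
  obtain ⟨b, hb, hbα⟩ := exists_isHomogeneous_coeff_eq d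
    (Function.extend (lowExponent d n) (α 1) 0)
  obtain ⟨c, hc, hcα⟩ := exists_isHomogeneous_coeff_eq d
    (Function.extend (lowExponent d n) (α 2) 0)
  obtain ⟨a, ha, haα⟩ := exists_isHomogeneous_coeff_eq d (Function.extend
    (Sum.elim (lowExponent d n) fun i => edgeExponent d n i + Finsupp.single 2 1)
    (Sum.elim (α 0) fun i => (γ i + coeff (edgeExponent d n i) (pderiv 1 b)) /
      (edgeExponent d n i 2 + 1)) 0)
  refine ⟨⟨![a, b, c], mem_formTriples.2 fun l => by fin_cases l; exacts [ha, hb, hc]⟩, ?_⟩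
  rw [lowCoeffs_apply]
  refine Prod.ext (funext fun l => funext fun q => ?_) (funext fun i => ?_)
  · fin_cases l
    · change coeff _ a = α 0 q
      rw [haα _ (degree_lowExponent h q)]
      exact (sumElim_lowExponent_injective d n).extend_apply _ _ (Sum.inl q)
    · change coeff _ b = α 1 q
      rw [hbα _ (degree_lowExponent h q), (lowExponent_injective d n).extend_apply]
    · change coeff _ c = α 2 q
      rw [hcα _ (degree_lowExponent h q), (lowExponent_injective d n).extend_apply]
  · change coeff _ (pderiv 2 a - pderiv 1 b) = γ i
    have hdeg : (edgeExponent d n i + Finsupp.single 2 1).degree = d := by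
      rw [map_add, degree_edgeExponent h, Finsupp.degree_single]
      have := i.2
      omega
    have hne : (edgeExponent d n i 2 + 1 : K) ≠ 0 := by
      exact_mod_cast (edgeExponent d n i 2).succ_ne_zero
    rw [coeff_sub, coeff_pderiv, haα _ hdeg]
    erw [(sumElim_lowExponent_injective d n).extend_apply _ _ (Sum.inr i)]
    rw [Sum.elim_inr, div_mul_cancel₀ _ hne, add_sub_cancel_right]

theorem mem_pow_iff_coeff_lowExponent {d n : ℕ} {F : MvPolynomial (Fin 3) K}
    (hF : F.IsHomogeneous d) : F ∈ pointIdeal (Pi.single 0 1 : Fin 3 → K) ^ n ↔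
      ∀ q, coeff (lowExponent d n q) F = 0 := by
  rw [mem_pow_pointIdeal_single]
  refine ⟨fun h q => h _ ?_, fun h x hx => ?_⟩
  · simp [lowExponent]
    omega
  · by_cases hd : x.degree = d
    · rw [degree_fin_three] at hd
      rw [← h ⟨⟨x 1 + x 2, hx⟩, ⟨x 1, by simp⟩⟩]
      congr 1
      ext l
      fin_cases l <;> simp [lowExponent]
      omega
    · exact hF.coeff_eq_zero hd

theorem ker_lowCoeffs [CharZero K] {d n : ℕ} (h : n ≤ d) :
    LinearMap.ker (lowCoeffs (K := K) d n) =
      gradedPart (omega2Rel (pointIdeal (Pi.single 0 1 : Fin 3 → K) ^ (n + 1))) d := by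
  ext x
  have hx := mem_formTriples.1 x.2
  change lowCoeffs d n x = 0 ↔ x.1 ∈ omega2Rel _
  rw [mem_omega2Rel_pow_single, lowCoeffs_apply, Prod.mk_eq_zero]
  simp only [funext_iff, Pi.zero_apply, mem_pow_iff_coeff_lowExponent (hx _)]
  refine and_congr_right fun hl => ⟨fun h' => ?_, fun h' i => ?_⟩
  · have hmem := fun l => (mem_pow_iff_coeff_lowExponent (hx l)).2 (hl l)
    simp only [mem_pow_pointIdeal_single] at hmem
    rw [mem_pow_pointIdeal_single]
    intro y hy
    by_cases hyn : y 1 + y 2 + 1 < n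
    · rw [coeff_sub, coeff_pderiv, coeff_pderiv, hmem 0 _ (by simp; omega),
        hmem 1 _ (by simp; omega)]
      simp
    · by_cases hd : y.degree = d - 1
      · rw [degree_fin_three] at hd
        rw [← h' ⟨y 1, by omega⟩]
        congr 1
        ext l
        fin_cases l <;> simp [edgeExponent] <;> omega
      · exact ((hx 0).pderiv.sub (hx 1).pderiv).coeff_eq_zero hd
  · refine (mem_pow_pointIdeal_single _ _).1 h' _ ?_
    simp [edgeExponent]
    omega

theorem quotientHF_pow_pointIdeal [CharZero K] {v : Fin 3 → K} (hv : v ≠ 0) {d n : ℕ}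
    (h : n ≤ d) : quotientHF (omega2Rel (pointIdeal v ^ (n + 1))) d =
      3 * ∑ k : Fin n, ((k : ℕ) + 1) + n := by
  rw [quotientHF_pointIdeal_congr hv (v := Pi.single 0 1) (by simp), quotientHF, ← ker_lowCoeffs h,
    (LinearMap.quotKerEquivOfSurjective _ (lowCoeffs_surjective h)).finrank_eq]
  simp [Module.finrank_prod, Module.finrank_pi_fintype]

end HilbertFunction

/-- Let `W = m_1 P_1 + ⋯ + m_s P_s` be a fat point scheme in `ℙ²` over a
field of characteristic zero. Then the Hilbert polynomial of `Ω²_{R_W/K}` is the constant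
`Σ_j (1/2)(3 m_j + 2)(m_j - 1)`. -/
theorem hilbertPolynomial_kaehler_two_forms_P2 {K : Type*} [Field K] [CharZero K]
    (s : ℕ) (hs : 0 < s)
    (v : Fin s → (Fin 3 → K))
    (hv0 : ∀ j, v j ≠ 0)
    (hdist : ∀ i j, i ≠ j → ∀ c : K, v i ≠ c • v j)
    (m : Fin s → ℕ) (hm : ∀ j, 1 ≤ m j) :
    ∃ i₀ : ℕ, ∀ i ≥ i₀,
      (omega2HF (⨅ j, (pointIdeal (v j)) ^ (m j)) i : ℚ) =
        ∑ j : Fin s, (3 * (m j : ℚ) + 2) * ((m j : ℚ) - 1) / 2 := by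
  have ht : ∀ j, ∃ N, ∀ d ≥ N, quotientHF (omega2Rel (pointIdeal (v j) ^ m j)) d =
      3 * ∑ k : Fin (m j - 1), ((k : ℕ) + 1) + (m j - 1) := fun j =>
    ⟨m j - 1, fun d hd => by
      rw [← quotientHF_pow_pointIdeal (hv0 j) hd, Nat.sub_add_cancel (hm j)]⟩
  obtain ⟨N, hN⟩ := exists_quotientHF_iInf_eq_sum v hv0 hdist m _ ht
  refine ⟨N + 2, fun i hi => ?_⟩
  change (quotientHF (omega2Rel _) (i - 2) : ℚ) = _
  rw [hN _ (by omega), Nat.cast_sum]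
  refine Finset.sum_congr rfl fun j _ => ?_
  obtain ⟨n, hn⟩ := Nat.exists_eq_add_of_le' (hm j)
  have hsum : ∀ n : ℕ, (∑ k : Fin n, ((k : ℚ) + 1)) = n * (n + 1) / 2 := fun n => by
    induction n with
    | zero => simp
    | succ n ih =>
      rw [Fin.sum_univ_castSucc]
      simp only [Fin.val_castSucc, Fin.val_last, ih]
      push_cast
      ring
  rw [hn, Nat.add_sub_cancel]
  push_cast
  rw [hsum]
  ring
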